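/- Let P = conv(v_0,...,v_n) with v_0,...,v_n linearly independent lattice vectors in R^{n+1}. Then the parallelepiped ◊P is a translate of a reflexive polytope if and only if the open parallelepiped box(P) contains exactly one lattice point and for every proper nonempty face G of P the open box box(G) contains at most one lattice point. -/

import Mathlib

open Matrix

section
variable {ι : Type*} [Fintype ι] [DecidableEq ι]

lemma pr_half (lam : ℝ) (h0 : 0 < lam) (h1 : lam < 1) (a b : ℤ)
    (ha : (0 - lam)⁻¹ = a) (hb : (1 - lam)⁻¹ = b) : lam = 1 / 2 := by
  have h2 : (0:ℝ) < 1 - lam := by linarith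
  have ha' : (-a : ℝ) * lam = 1 := by rw [← ha, zero_sub, inv_neg, neg_neg, inv_mul_cancel₀ h0.ne']
  have hb' : (b : ℝ) * (1 - lam) = 1 := by rw [← hb]; field_simp
  have e : (-a - 1) * (b - 1) = 1 := by
    have : ((-a - 1) * (b - 1) : ℝ) = 1 := by
      have hl : lam * (1 - lam) ≠ 0 := by positivity
      apply mul_right_cancel₀ hl
      linear_combination (b - 1) * (1 - lam) * ha' + (1 - lam) * hb'
    exact_mod_cast this
  have hb1 : 1 < b := by
    have : (1:ℝ) < b := by nlinarith
    exact_mod_cast this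
  rcases Int.mul_eq_one_iff_eq_one_or_neg_one.1 e with ⟨_, h⟩ | ⟨_, h⟩
  · have : b = 2 := by omega
    subst this
    push_cast at hb'
    linarith
  · omega

lemma pr_coord (V N : Matrix ι ι ℝ) (hVN : V * N = 1) (x lam : ι → ℝ)
    (h : x = lam ᵥ* V) : x ᵥ* N = lam := by
  rw [h, vecMul_vecMul, hVN, vecMul_one]

lemma pr_interior (V N : Matrix ι ι ℝ) (hVN : V * N = 1) (w : ι → ℝ)
    (h0 : (0 : ι → ℝ) ∈ interior {x : ι → ℝ | ∃ lam : ι → ℝ, (∀ i, 0 ≤ lam i ∧ lam i ≤ 1) ∧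
      x + w = lam ᵥ* V}) (i : ι) : 0 < (w ᵥ* N) i ∧ (w ᵥ* N) i < 1 := by
  have hc : Filter.Tendsto (fun t : ℝ => t • V i) (nhds 0) (nhds (0 : ι → ℝ)) := by
    have : Continuous (fun t : ℝ => t • V i) := by fun_prop
    simpa using this.tendsto 0
  have := hc.eventually (mem_interior_iff_mem_nhds.1 h0)
  obtain ⟨ε, hε, H⟩ := Metric.eventually_nhds_iff.1 this
  have key : ∀ t : ℝ, |t| < ε → 0 ≤ t + (w ᵥ* N) i ∧ t + (w ᵥ* N) i ≤ 1 := by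
    intro t ht
    obtain ⟨lam, hl, e⟩ := H (y := t) (by simpa using ht)
    have e2 := pr_coord V N hVN _ _ e
    have : (V i) ᵥ* N = Pi.single i 1 := by
      apply pr_coord V N hVN
      simp
      rfl
    rw [add_vecMul, smul_vecMul, this] at e2
    have := congrFun e2 i
    simp at this
    rw [this]; exact hl i
  have k1 := key (ε/2) (by rw [abs_of_pos] <;> linarith)
  have k2 := key (-(ε/2)) (by rw [abs_neg, abs_of_pos] <;> linarith)
  constructor <;> linarith [k1.2, k2.1]

lemma pr_extreme (V N : Matrix ι ι ℝ) (hVN : V * N = 1) (hNV : N * V = 1) (w : ι → ℝ)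
    (hw : ∀ i, 0 < (w ᵥ* N) i ∧ (w ᵥ* N) i < 1) (T : Set (ι → ℝ))
    (hT : {y : ι → ℝ | ∀ x ∈ {x : ι → ℝ | ∃ lam : ι → ℝ, (∀ i, 0 ≤ lam i ∧ lam i ≤ 1) ∧
      x + w = lam ᵥ* V}, y ⬝ᵥ x ≤ 1} = convexHull ℝ T) (i : ι) (t : ℝ) (ht : t = 0 ∨ t = 1) :
    (t - (w ᵥ* N) i)⁻¹ • (N *ᵥ Pi.single i 1) ∈ T := by
  set l := w ᵥ* N with hl
  have hwl : w = l ᵥ* V := by rw [hl, vecMul_vecMul, hNV, vecMul_one]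
  have hlt : t - l i ≠ 0 := by
    rcases ht with rfl | rfl
    · have := (hw i).1; intro h; linarith
    · have := (hw i).2; intro h; linarith
  apply extremePoints_convexHull_subset (𝕜 := ℝ)
  rw [← hT]
  have hpair : ∀ lam : ι → ℝ,
      ((t - l i)⁻¹ • (N *ᵥ Pi.single i 1)) ⬝ᵥ (lam ᵥ* V - w) = (t - l i)⁻¹ * (lam i - l i) := by
    intro lam
    rw [hwl, ← sub_vecMul, smul_dotProduct, dotProduct_comm, ← dotProduct_mulVec,
      mulVec_mulVec, hVN, one_mulVec]
    simp
  rw [mem_extremePoints]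
  refine ⟨?_, ?_⟩
  · rintro x ⟨lam, hlam, e⟩
    have : x = lam ᵥ* V - w := by rw [← e]; simp
    rw [this, hpair]
    rcases ht with rfl | rfl
    · have := (hw i).1
      rw [inv_mul_eq_div, div_le_one_of_neg (by linarith)]
      linarith [(hlam i).1]
    · have := (hw i).2
      rw [inv_mul_eq_div, div_le_one (by linarith)]
      linarith [(hlam i).2]
  · have ht' : 0 ≤ t ∧ t ≤ 1 := by rcases ht with rfl | rfl <;> norm_num
    have main : ∀ y1 y2 : ι → ℝ, 
        (∀ x ∈ {x : ι → ℝ | ∃ lam : ι → ℝ, (∀ i, 0 ≤ lam i ∧ lam i ≤ 1) ∧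
          x + w = lam ᵥ* V}, y1 ⬝ᵥ x ≤ 1) → 
        (∀ x ∈ {x : ι → ℝ | ∃ lam : ι → ℝ, (∀ i, 0 ≤ lam i ∧ lam i ≤ 1) ∧
          x + w = lam ᵥ* V}, y2 ⬝ᵥ x ≤ 1) → 
        (t - l i)⁻¹ • (N *ᵥ Pi.single i 1) ∈ openSegment ℝ y1 y2 → 
          y1 = (t - l i)⁻¹ • (N *ᵥ Pi.single i 1) := by
      rintro y1 y2 h1 h2 ⟨a, b, ha, hb, hab, e⟩
      have fac : ∀ lam : ι → ℝ, (∀ i, 0 ≤ lam i ∧ lam i ≤ 1) → lam i = t →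
          (lam - l) ⬝ᵥ (V *ᵥ y1) = 1 := by
        intro lam hlam hi
        have p := hpair lam
        rw [← e, hi, inv_mul_cancel₀ hlt, add_dotProduct, smul_dotProduct, smul_dotProduct] at p
        have q1 := h1 (lam ᵥ* V - w) ⟨lam, hlam, by simp⟩
        have q2 := h2 (lam ᵥ* V - w) ⟨lam, hlam, by simp⟩
        simp only [smul_eq_mul] at p
        have : y1 ⬝ᵥ (lam ᵥ* V - w) = 1 := by nlinarith
        rw [← this, dotProduct_mulVec, dotProduct_comm, sub_vecMul, ← hwl]
      have f0 := fac (Pi.single i t) (by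
        intro k
        by_cases hk : k = i
        · subst hk; simpa using ht'
        · simp [hk]) (by simp)
      have fk : ∀ k, k ≠ i → (V *ᵥ y1) k = 0 := by
        intro k hk
        have f1 := fac (Pi.single i t + Pi.single k 1) (by
          intro j
          by_cases hj : j = i
          · subst hj; simpa [hk.symm] using ht'
          · by_cases hj' : j = k
            · subst hj'; simp [hj]
            · simp [hj, hj']) (by simp [hk.symm])
        rw [add_sub_right_comm, add_dotProduct, f0] at f1
        simpa using f1
      have hsing : V *ᵥ y1 = Pi.single i ((V *ᵥ y1) i) := by
        ext k
        by_cases hk : k = i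
        · subst hk; simp
        · simp [hk, fk k hk]
      have hv : (V *ᵥ y1) i = (t - l i)⁻¹ := by
        rw [hsing] at f0
        simp at f0
        exact eq_inv_of_mul_eq_one_right f0
      have : y1 = N *ᵥ (V *ᵥ y1) := by rw [mulVec_mulVec, hNV, one_mulVec]
      rw [this, hsing, hv, ← mulVec_smul]
      congr 1
      ext k
      by_cases hk : k = i
      · subst hk; simp
      · simp [hk]
    intro y1 h1 y2 h2 hs
    exact ⟨main y1 y2 h1 h2 hs, main y2 y1 h2 h1 (by rwa [openSegment_symm])⟩

lemma pr_dual (V N : Matrix ι ι ℝ) (hVN : V * N = 1) (hNV : N * V = 1) (w : ι → ℝ) [Nonempty ι]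
    (hw : w = (fun _ => 1/2) ᵥ* V) :
    {y : ι → ℝ | ∀ x ∈ {x : ι → ℝ | ∃ lam : ι → ℝ, (∀ i, 0 ≤ lam i ∧ lam i ≤ 1) ∧
      x + w = lam ᵥ* V}, y ⬝ᵥ x ≤ 1} = convexHull ℝ 
        (Set.range (Sum.elim (fun i => N *ᵥ Pi.single i 2) (fun i => N *ᵥ Pi.single i (-2)))) := by
  apply Set.Subset.antisymm
  · intro y hy
    set a := V *ᵥ y with ha
    have hya : y = N *ᵥ a := by rw [ha, mulVec_mulVec, hNV, one_mulVec]
    have hsum : ∑ i, |a i| / 2 ≤ 1 := by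
      have := hy ((fun i => if 0 ≤ a i then 1/2 else -(1/2)) ᵥ* V)
        ⟨fun i => if 0 ≤ a i then 1 else 0, fun i => by dsimp only; split_ifs <;> norm_num, by
          rw [hw, ← add_vecMul]; congr 1; ext i; simp only [Pi.add_apply]
          split_ifs <;> norm_num⟩
      rw [dotProduct_comm, ← dotProduct_mulVec, ← ha] at this
      refine le_trans (le_of_eq ?_) this
      apply Finset.sum_congr rfl
      intro i _
      dsimp only
      split_ifs with h
      · rw [abs_of_nonneg h]; ring
      · rw [abs_of_neg (not_le.1 h)]; ring
    set r := (1 - ∑ i, |a i| / 2) / (2 * Fintype.card ι) with hr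
    have hr0 : 0 ≤ r := div_nonneg (by linarith) (by positivity)
    have hcard : (Fintype.card ι : ℝ) ≠ 0 := by simp
    have := (convex_convexHull ℝ (Set.range (Sum.elim (fun i => N *ᵥ Pi.single i (2:ℝ)) (fun i => N *ᵥ Pi.single i (-2))))).sum_mem (t := Finset.univ)
      (w := Sum.elim (fun i => (|a i| + a i) / 4 + r) (fun i => (|a i| - a i) / 4 + r))
      (z := Sum.elim (fun i => N *ᵥ Pi.single i 2) (fun i => N *ᵥ Pi.single i (-2)))
      (by 
        rintro (i | i) _
        · simp only [Sum.elim_inl]; linarith [neg_abs_le (a i)]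
        · simp only [Sum.elim_inr]; linarith [le_abs_self (a i)])
      (by
        simp only [Fintype.sum_sum_type, Sum.elim_inl, Sum.elim_inr]
        rw [← Finset.sum_add_distrib]
        have : ∀ i, (|a i| + a i) / 4 + r + ((|a i| - a i) / 4 + r) = |a i| / 2 + 2 * r := by
          intro i; ring
        simp only [this, Finset.sum_add_distrib, Finset.sum_const, Finset.card_univ, nsmul_eq_mul]
        rw [hr]; field_simp; ring)
      (fun i _ => subset_convexHull ℝ _ (Set.mem_range_self i))
    convert this using 1
    simp only [Fintype.sum_sum_type, Sum.elim_inl, Sum.elim_inr]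
    simp only [← mulVec_smul]
    rw [← mulVec_sum, ← mulVec_sum, ← mulVec_add, hya]
    congr 1
    ext k
    simp [Finset.sum_apply, Pi.single_apply]
    ring
  · apply convexHull_min
    · rintro _ ⟨(i | i), rfl⟩ x ⟨lam, hlam, e⟩
      all_goals
        have hx : x = (lam - fun _ => 1/2) ᵥ* V := by rw [sub_vecMul, ← e, ← hw]; simp
        simp only [Sum.elim_inl, Sum.elim_inr]
        rw [hx, dotProduct_comm, ← dotProduct_mulVec, mulVec_mulVec, hVN, one_mulVec]
        have := hlam i
        simp
        linarith
    · intro y1 h1 y2 h2 a b ha hb hab x hx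
      have q1 := h1 x hx
      have q2 := h2 x hx
      rw [add_dotProduct, smul_dotProduct, smul_dotProduct, smul_eq_mul, smul_eq_mul]
      nlinarith

lemma pr_mem_interior (V N : Matrix ι ι ℝ) (hNV : N * V = 1) (w : ι → ℝ)
    (hVN : V * N = 1) (hw : w = (fun _ => 1/2) ᵥ* V) :
    (0 : ι → ℝ) ∈ interior {x : ι → ℝ | ∃ lam : ι → ℝ, (∀ i, 0 ≤ lam i ∧ lam i ≤ 1) ∧
      x + w = lam ᵥ* V} := by
  rw [mem_interior]
  refine ⟨{x | ∀ i, 0 < ((x + w) ᵥ* N) i ∧ ((x + w) ᵥ* N) i < 1}, ?_, ?_, ?_⟩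
  · intro x hx
    exact ⟨(x + w) ᵥ* N, fun i => ⟨(hx i).1.le, (hx i).2.le⟩, by
      rw [vecMul_vecMul, hNV, vecMul_one]⟩
  · simp only [Set.ofPred_forall]
    apply isOpen_iInter_of_finite
    intro i
    have : Continuous (fun x : ι → ℝ => ((x + w) ᵥ* N) i) := by
      simp only [vecMul, dotProduct]
      fun_prop
    exact (isOpen_lt continuous_const this).inter (isOpen_lt this continuous_const)
  · intro i
    rw [zero_add, pr_coord V N hVN w _ hw]
    norm_num

lemma pr_box_finite (v : ι → ι → ℤ) (G : Finset ι) :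
    {x : ι → ℤ | ∃ lam : ι → ℝ, (∀ i ∈ G, 0 < lam i ∧ lam i < 1) ∧
          ∀ j, (x j : ℝ) = ∑ i ∈ G, lam i * (v i j : ℝ)}.Finite := by
  apply (Set.finite_Icc (fun j => -∑ i ∈ G, |v i j|) (fun j => ∑ i ∈ G, |v i j|)).subset
  rintro x ⟨lam, hl, e⟩
  have : ∀ j, |x j| ≤ ∑ i ∈ G, |v i j| := by
    intro j
    have : (|x j| : ℝ) ≤ ∑ i ∈ G, |(v i j : ℝ)| := by
      rw [e j]
      refine (Finset.abs_sum_le_sum_abs _ _).trans (Finset.sum_le_sum fun i hi => ?_)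
      rw [abs_mul, abs_of_pos (hl i hi).1]
      exact mul_le_of_le_one_left (abs_nonneg _) (hl i hi).2.le
    exact_mod_cast this
  exact ⟨fun j => (abs_le.1 (this j)).1, fun j => (abs_le.1 (this j)).2⟩

lemma pr_box_half (v : ι → ι → ℤ) (N : Matrix ι ι ℝ)
    (hVN : (Matrix.of fun i j => (v i j : ℝ)) * N = 1)
    (G : Finset ι) 
    (hs : {x : ι → ℤ | ∃ lam : ι → ℝ, (∀ i ∈ G, 0 < lam i ∧ lam i < 1) ∧
          ∀ j, (x j : ℝ) = ∑ i ∈ G, lam i * (v i j : ℝ)}.Subsingleton)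
    (x : ι → ℤ) (lam : ι → ℝ) (hl : ∀ i ∈ G, 0 < lam i ∧ lam i < 1)
    (e : ∀ j, (x j : ℝ) = ∑ i ∈ G, lam i * (v i j : ℝ)) : ∀ i ∈ G, lam i = 1 / 2 := by
  have := hs (x := x) ⟨lam, hl, e⟩ (y := fun j => ∑ i ∈ G, v i j - x j)
    ⟨fun i => 1 - lam i, fun i hi => ⟨by linarith [(hl i hi).2], by linarith [(hl i hi).1]⟩, by
      intro j
      push_cast
      rw [e j, ← Finset.sum_sub_distrib]
      exact Finset.sum_congr rfl fun i _ => by ring⟩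
  have h2 : (0 : ι → ℝ) = (fun i => if i ∈ G then 2 * lam i - 1 else 0) ᵥ* 
      (Matrix.of fun i j => (v i j : ℝ)) := by
    ext j
    have e1 := congrFun this j
    have e2 : (x j : ℝ) = ∑ i ∈ G, (v i j : ℝ) - x j := by exact_mod_cast e1
    simp only [vecMul, dotProduct, Matrix.of_apply, ite_mul, zero_mul, Finset.sum_ite_mem,
      Finset.univ_inter, Pi.zero_apply]
    simp only [sub_mul, Finset.sum_sub_distrib, one_mul, mul_assoc, ← Finset.mul_sum]
    rw [← e j]; linarith
  have h3 := pr_coord _ N hVN _ _ h2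
  intro i hi
  have h4 := congrFun h3 i
  simp [hi] at h4
  linarith

lemma pr_int (v : ι → ι → ℤ) (N : Matrix ι ι ℝ)
    (hNV : N * (Matrix.of fun i j => (v i j : ℝ)) = 1)
    (hVN : (Matrix.of fun i j => (v i j : ℝ)) * N = 1)
    (hs : ∀ G : Finset ι, G ≠ ∅ → {x : ι → ℤ | ∃ lam : ι → ℝ, (∀ i ∈ G, 0 < lam i ∧ lam i < 1) ∧
          ∀ j, (x j : ℝ) = ∑ i ∈ G, lam i * (v i j : ℝ)}.Subsingleton)
    (x : ι → ℤ) (i : ι) : ∃ z : ℤ, 2 * ((fun j => (x j : ℝ)) ᵥ* N) i = z := by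
  classical
  set c := (fun j => (x j : ℝ)) ᵥ* N with hc
  have hx : (fun j => (x j : ℝ)) = c ᵥ* (Matrix.of fun i j => (v i j : ℝ)) := by
    rw [hc, vecMul_vecMul, hNV, vecMul_one]
  set G : Finset ι := Finset.univ.filter fun i => Int.fract (c i) ≠ 0 with hG
  by_cases hi : i ∈ G
  · have := pr_box_half v N hVN G (hs G (Finset.ne_empty_of_mem hi))
      (fun j => x j - ∑ i, ⌊c i⌋ * v i j) (fun i => Int.fract (c i)) (fun i hi => by
        have : Int.fract (c i) ≠ 0 := by simpa [hG] using hi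
        exact ⟨lt_of_le_of_ne (Int.fract_nonneg _) this.symm, Int.fract_lt_one _⟩) (by
        intro j
        have e := congrFun hx j
        simp only [vecMul, dotProduct, Matrix.of_apply] at e
        push_cast
        rw [e, ← Finset.sum_sub_distrib]
        symm
        apply Finset.sum_subset_zero_on_sdiff (Finset.subset_univ G)
        · intro k hk
          have : Int.fract (c k) = 0 := by simpa [hG] using hk
          rw [← sub_mul, Int.self_sub_floor, this, zero_mul]
        · intro k _
          rw [← sub_mul, Int.self_sub_floor]) i hi
    refine ⟨2 * ⌊c i⌋ + 1, ?_⟩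
    push_cast
    have h := Int.floor_add_fract (c i)
    linarith
  · have : Int.fract (c i) = 0 := by simpa [hG] using hi
    refine ⟨2 * ⌊c i⌋, ?_⟩
    push_cast
    have h := Int.floor_add_fract (c i)
    linarith

lemma pr_half_of_int (c : ℝ) (h0 : 0 < c) (h1 : c < 1) (z : ℤ) (h : 2 * c = z) : c = 1 / 2 := by
  have a : (0:ℝ) < z := by linarith
  have b : (z:ℝ) < 2 := by linarith
  have a' : 0 < z := by exact_mod_cast a
  have b' : z < 2 := by exact_mod_cast b
  have : z = 1 := by omega
  subst this
  push_cast at h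
  linarith

/-- Box points have coordinates one half when twice the dual basis is integral. -/
lemma pr_box_of_int (v : ι → ι → ℤ) (N : Matrix ι ι ℝ)
    (hVN : (Matrix.of fun i j => (v i j : ℝ)) * N = 1)
    (hz : ∀ j i, ∃ z : ℤ, 2 * N j i = z)
    (G : Finset ι) (x : ι → ℤ) (lam : ι → ℝ) (hl : ∀ i ∈ G, 0 < lam i ∧ lam i < 1)
    (e : ∀ j, (x j : ℝ) = ∑ i ∈ G, lam i * (v i j : ℝ)) (i : ι) (hi : i ∈ G) :
    lam i = 1 / 2 := by
  choose z hz using hz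
  have h2 : (fun j => (x j : ℝ)) = (fun i => if i ∈ G then lam i else 0) ᵥ* 
      (Matrix.of fun i j => (v i j : ℝ)) := by
    ext j
    simp [vecMul, dotProduct, e j]
  have h3 := congrFun (pr_coord _ N hVN _ _ h2) i
  simp only [hi, if_true] at h3
  apply pr_half_of_int _ (hl i hi).1 (hl i hi).2 (∑ j, x j * z j i)
  rw [← h3]
  push_cast
  simp only [vecMul, dotProduct, Finset.mul_sum]
  exact Finset.sum_congr rfl fun j _ => by rw [← hz]; ring
end

/-- Let `P = ⟨v_0,…,v_n⟩` with `v_0,…,v_n` linearly independent lattice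
vectors in `ℝ^{n+1}`.  Then the parallelepiped `◊P` is a translate of a
reflexive polytope (a full-dimensional lattice polytope containing the origin
in its interior whose polar dual is again a lattice polytope) if and only if
the open box `box(P)` contains exactly one lattice point and, for every
proper nonempty face `G` of `P`, the open box `box(G)` contains at most one
lattice point. -/
theorem parallelepiped_reflexive_iff (n : ℕ)
    (v : Fin (n + 1) → Fin (n + 1) → ℤ)
    (hv : LinearIndependent ℝ (fun i => fun j => (v i j : ℝ))) :
    (∃ w : Fin (n + 1) → ℤ,
      (0 : Fin (n + 1) → ℝ) ∈ interior {x : Fin (n + 1) → ℝ |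
          ∃ lam : Fin (n + 1) → ℝ, (∀ i, 0 ≤ lam i ∧ lam i ≤ 1) ∧
            ∀ j, x j + (w j : ℝ) = ∑ i, lam i * (v i j : ℝ)} ∧
      ∃ Vd : Finset (Fin (n + 1) → ℤ),
        {y : Fin (n + 1) → ℝ |
            ∀ x ∈ {x : Fin (n + 1) → ℝ | ∃ lam : Fin (n + 1) → ℝ,
                (∀ i, 0 ≤ lam i ∧ lam i ≤ 1) ∧
                ∀ j, x j + (w j : ℝ) = ∑ i, lam i * (v i j : ℝ)},
              ∑ j, y j * x j ≤ 1}
          = convexHull ℝ ((fun z : Fin (n + 1) → ℤ => fun j => (z j : ℝ)) '' ↑Vd))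
    ↔
    (Set.ncard {x : Fin (n + 1) → ℤ | ∃ lam : Fin (n + 1) → ℝ,
        (∀ i, 0 < lam i ∧ lam i < 1) ∧
        ∀ j, (x j : ℝ) = ∑ i, lam i * (v i j : ℝ)} = 1 ∧
      ∀ G : Finset (Fin (n + 1)), G ≠ ∅ → G ≠ Finset.univ →
        Set.ncard {x : Fin (n + 1) → ℤ | ∃ lam : Fin (n + 1) → ℝ,
          (∀ i ∈ G, 0 < lam i ∧ lam i < 1) ∧
          ∀ j, (x j : ℝ) = ∑ i ∈ G, lam i * (v i j : ℝ)} ≤ 1) := by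
  classical
  set V : Matrix (Fin (n+1)) (Fin (n+1)) ℝ := Matrix.of fun i j => (v i j : ℝ) with hV
  have hunit : IsUnit V := Matrix.linearIndependent_rows_iff_isUnit.1 hv
  have hdet := (Matrix.isUnit_iff_isUnit_det V).1 hunit
  set N := V⁻¹ with hN
  have hVN : V * N = 1 := Matrix.mul_nonsing_inv V hdet
  have hNV : N * V = 1 := Matrix.nonsing_inv_mul V hdet
  have hset : ∀ w : Fin (n+1) → ℤ, {x : Fin (n + 1) → ℝ |
          ∃ lam : Fin (n + 1) → ℝ, (∀ i, 0 ≤ lam i ∧ lam i ≤ 1) ∧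
            ∀ j, x j + (w j : ℝ) = ∑ i, lam i * (v i j : ℝ)} = 
        {x : Fin (n+1) → ℝ | ∃ lam : Fin (n+1) → ℝ, (∀ i, 0 ≤ lam i ∧ lam i ≤ 1) ∧
      x + (fun j => (w j : ℝ)) = lam ᵥ* V} := by
    intro w
    ext x
    simp only [Set.mem_setOf_eq, funext_iff]
    rfl
  simp only [hset]
  constructor
  · rintro ⟨w, h0, Vd, hVd⟩
    have hint := pr_interior V N hVN _ h0
    have hex := pr_extreme V N hVN hNV _ hint _ hVd
    set l := (fun j => (w j : ℝ)) ᵥ* N with hl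
    have hwl : (fun j => (w j : ℝ)) = l ᵥ* V := by rw [hl, vecMul_vecMul, hNV, vecMul_one]
    have hinv : ∀ i t, (t = 0 ∨ t = 1) → ∃ a : ℤ, (t - l i)⁻¹ = a := by
      intro i t ht
      obtain ⟨z, _, hz⟩ := hex i t ht
      refine ⟨∑ j, v i j * z j, ?_⟩
      have h1 : (V *ᵥ (fun j => (z j : ℝ))) i = (t - l i)⁻¹ := by
        dsimp only at hz
        rw [hz, mulVec_smul, mulVec_mulVec, hVN, one_mulVec]
        simp
      rw [← h1]
      push_cast
      rfl
    have hhalf : ∀ i, l i = 1 / 2 := by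
      intro i
      obtain ⟨a, ha⟩ := hinv i 0 (Or.inl rfl)
      obtain ⟨b, hb⟩ := hinv i 1 (Or.inr rfl)
      exact pr_half _ (hint i).1 (hint i).2 a b ha hb
    have hz : ∀ j i, ∃ z : ℤ, 2 * N j i = z := by
      intro j i
      obtain ⟨z, _, hz⟩ := hex i 1 (Or.inr rfl)
      refine ⟨z j, ?_⟩
      have := congrFun hz j
      dsimp only at this
      rw [this, hhalf i]
      simp
      norm_num
    refine ⟨?_, ?_⟩
    · rw [Set.ncard_eq_one]
      refine ⟨w, ?_⟩
      apply Set.eq_singleton_iff_unique_mem.2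
      refine ⟨⟨l, hint, fun j => congrFun hwl j⟩, ?_⟩
      rintro x ⟨lam, hlam, e⟩
      have := pr_box_of_int v N hVN hz Finset.univ x lam (fun i _ => hlam i) e
      ext j
      have e1 := e j
      have e2 : (w j : ℝ) = ∑ i, l i * (v i j : ℝ) := congrFun hwl j
      have : (x j : ℝ) = w j := by
        rw [e1, e2]
        exact Finset.sum_congr rfl fun i hi => by rw [this i hi, hhalf i]
      exact_mod_cast this
    · intro G _ _
      rw [Set.ncard_le_one (pr_box_finite v G)]
      rintro x ⟨lam, hlam, e⟩ y ⟨lam', hlam', e'⟩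
      have h1 := pr_box_of_int v N hVN hz G x lam hlam e
      have h2 := pr_box_of_int v N hVN hz G y lam' hlam' e'
      ext j
      have : (x j : ℝ) = y j := by
        rw [e j, e' j]
        exact Finset.sum_congr rfl fun i hi => by rw [h1 i hi, h2 i hi]
      exact_mod_cast this
  · rintro ⟨h1, hG⟩
    have hs : ∀ G : Finset (Fin (n+1)), G ≠ ∅ → {x : Fin (n+1) → ℤ | ∃ lam : Fin (n+1) → ℝ,
        (∀ i ∈ G, 0 < lam i ∧ lam i < 1) ∧
          ∀ j, (x j : ℝ) = ∑ i ∈ G, lam i * (v i j : ℝ)}.Subsingleton := by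
      intro G hne
      by_cases hu : G = Finset.univ
      · subst hu
        have := h1.le
        have hfin := pr_box_finite v Finset.univ
        simp only [Finset.mem_univ, true_imp_iff] at hfin ⊢
        exact fun x hx y hy => (Set.ncard_le_one hfin).1 this x hx y hy
      · exact fun x hx y hy => (Set.ncard_le_one (pr_box_finite v G)).1 (hG G hne hu) x hx y hy
    obtain ⟨w, hw⟩ := Set.ncard_eq_one.1 h1
    obtain ⟨lam, hlam, e⟩ : w ∈ {x : Fin (n + 1) → ℤ | ∃ lam : Fin (n + 1) → ℝ,
        (∀ i, 0 < lam i ∧ lam i < 1) ∧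
        ∀ j, (x j : ℝ) = ∑ i, lam i * (v i j : ℝ)} := by rw [hw]; rfl
    have hhalf := pr_box_half v N hVN Finset.univ (hs _ (Finset.univ_nonempty.ne_empty))
      w lam (fun i _ => hlam i) e
    have hw2 : (fun j => (w j : ℝ)) = (fun _ => 1/2) ᵥ* V := by
      ext j
      rw [e j]
      exact Finset.sum_congr rfl fun i hi => by rw [hhalf i hi]; rfl
    have hz : ∀ j i, ∃ z : ℤ, 2 * N j i = z := by
      intro j i
      obtain ⟨z, hz⟩ := pr_int v N hNV hVN hs (Pi.single j 1) i
      refine ⟨z, ?_⟩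
      rw [← hz]
      have : (fun k => ((Pi.single j 1 : Fin (n+1) → ℤ) k : ℝ)) = Pi.single j 1 := by
        ext k
        by_cases hk : k = j
        · subst hk; simp
        · simp [hk]
      rw [this, single_one_vecMul]
      rfl
    choose z hz using hz
    refine ⟨w, pr_mem_interior V N hNV _ hVN hw2, 
      Finset.univ.image (Sum.elim (fun i j => z j i) (fun i j => - z j i)), ?_⟩
    refine (pr_dual V N hVN hNV _ hw2).trans ?_
    congr 1
    rw [Finset.coe_image, Finset.coe_univ, Set.image_univ, ← Set.range_comp]
    congr 1
    ext (i | i) j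
    · simp [← hz, mul_comm]
    · simp [← hz, mul_comm]
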